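/- Variance bound for the Bonnet–Price estimator of the Bures–Wasserstein gradient (Lemma 3.3): Let q = N(m,Σ) be a Gaussian with positive-definite covariance, let q_* = N(m_*,Σ_*) satisfy the stationarity conditions ∫ ∇U dq_* = 0 and ∫ ∇²U dq_* = Σ_*^{-1}, and let ψ be any coupling of q and q_*. Write g_* = ∫ ∇U dq_* and H_* = ∫ ∇²U dq_*. Then, integrating over z ∼ q independently of (x, x_*) ∼ ψ, ∫∫ ‖( ∇U(z) + ∇²U(z)(x − m) ) − ( g_* + H_*(x_* − m_*) )‖² dψ(x, x_*) dq(z) ≤ 10Lκ · ∫ D_U(x, x_*) dψ(x, x_*) + 10dL. -/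

import Mathlib

open MeasureTheory Matrix Real
open scoped RealInnerProductSpace

noncomputable section

/-- `ℝ^d` as a Euclidean space. -/
abbrev Vec (d : ℕ) := EuclideanSpace ℝ (Fin d)

/-- `d × d` real matrices. -/
abbrev Mat (d : ℕ) := Matrix (Fin d) (Fin d) ℝ

variable {d : ℕ}

/-- Matrix-vector product as a map on Euclidean space. -/
def matVec (A : Mat d) (x : Vec d) : Vec d :=
  (EuclideanSpace.equiv (Fin d) ℝ).symm (A.mulVec (EuclideanSpace.equiv (Fin d) ℝ x))

/-- The Gaussian measure `N(m, S)` on `ℝ^d` with mean `m` and covariance `S`,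
defined via its density with respect to Lebesgue measure.  (For `S` positive
definite this is the usual Gaussian probability measure.) -/
def gaussian (m : Vec d) (S : Mat d) : Measure (Vec d) :=
  volume.withDensity fun x =>
    ENNReal.ofReal (Real.sqrt (((2 * π) ^ d * S.det)⁻¹) *
      Real.exp (-⟪x - m, matVec S⁻¹ (x - m)⟫ / 2))

/-- The Hessian of `f : ℝ^d → ℝ` at `x`, as a `d × d` matrix. -/
def hess (f : Vec d → ℝ) (x : Vec d) : Mat d :=
  Matrix.of fun i j =>
    fderiv ℝ (fun y => fderiv ℝ f y (EuclideanSpace.single j 1)) x (EuclideanSpace.single i 1)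

/-- Frobenius norm of a matrix. -/
def frobNorm (A : Mat d) : ℝ := Real.sqrt (∑ i, ∑ j, (A i j) ^ 2)

/-- Squared Frobenius norm of a matrix. -/
def frobSq (A : Mat d) : ℝ := ∑ i, ∑ j, (A i j) ^ 2

/-- Jacobian of `g : ℝ^d → ℝ^d` at `x`: `(jacobian g x) i j = ∂ g_j / ∂ x_i`. -/
def jacobian (g : Vec d → Vec d) (x : Vec d) : Mat d :=
  Matrix.of fun i j => fderiv ℝ (fun y => g y j) x (EuclideanSpace.single i 1)

/-- Integral of the gradient of `U` against a measure. -/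
def intGrad (U : Vec d → ℝ) (q : Measure (Vec d)) : Vec d := ∫ x, gradient U x ∂q

/-- Entrywise integral of the Hessian of `U` against a measure. -/
def intHess (U : Vec d → ℝ) (q : Measure (Vec d)) : Mat d :=
  Matrix.of fun i j => ∫ x, hess U x i j ∂q

/-- The variational free energy of the Gaussian `N(m,S)`:
`F(m,Σ) = ∫ U dN(m,Σ) − (1/2)·log((2πe)^d · det Σ)`. -/
def freeEnergy (U : Vec d → ℝ) (m : Vec d) (S : Mat d) : ℝ :=
  (∫ x, U x ∂(gaussian m S)) - (1 / 2) * Real.log ((2 * π * Real.exp 1) ^ d * S.det)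

/-- Bregman divergence of `U`: `D_U(x,y) = U(x) − U(y) − ⟨∇U(y), x − y⟩`. -/
def bregman (U : Vec d → ℝ) (x y : Vec d) : ℝ := U x - U y - ⟪gradient U y, x - y⟫

/-- `ψ` is a coupling of `p` and `q`: a probability measure on the product whose
marginals are `p` and `q`. -/
def IsCoupling (ψ : Measure (Vec d × Vec d)) (p q : Measure (Vec d)) : Prop :=
  IsProbabilityMeasure ψ ∧ ψ.map Prod.fst = p ∧ ψ.map Prod.snd = q

/-! ### Matrices acting on Euclidean space -/

lemma matVec_apply (A : Mat d) (v : Vec d) (i : Fin d) : matVec A v i = ∑ j, A i j * v j := rfl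

lemma inner_eq_sum (u v : Vec d) : ⟪u, v⟫ = ∑ i, u i * v i := by
  simp [PiLp.inner_apply, mul_comm]

lemma inner_matVec (A : Mat d) (u v : Vec d) :
    ⟪u, matVec A v⟫ = ∑ i, ∑ j, A i j * (u i * v j) := by
  rw [inner_eq_sum]
  refine Finset.sum_congr rfl fun i _ => ?_
  rw [matVec_apply, Finset.mul_sum]
  exact Finset.sum_congr rfl fun j _ => by ring

lemma inner_single_one (v : Vec d) (i : Fin d) : ⟪v, EuclideanSpace.single i (1 : ℝ)⟫ = v i := by
  simp [inner_eq_sum]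

lemma matVec_add (A : Mat d) (u v : Vec d) : matVec A (u + v) = matVec A u + matVec A v := by
  ext i
  simp [matVec_apply, mul_add, Finset.sum_add_distrib]

lemma matVec_smul (A : Mat d) (c : ℝ) (v : Vec d) : matVec A (c • v) = c • matVec A v := by
  ext i
  simp [matVec_apply, Finset.mul_sum, mul_left_comm]

lemma matVec_sub (A : Mat d) (u v : Vec d) : matVec A (u - v) = matVec A u - matVec A v := by
  ext i
  simp [matVec_apply, mul_sub, Finset.sum_sub_distrib]

lemma matVec_mul (A B : Mat d) (v : Vec d) : matVec (A * B) v = matVec A (matVec B v) :=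
  congrArg (WithLp.toLp 2) (Matrix.mulVec_mulVec _ A B).symm

lemma matVec_one (v : Vec d) : matVec (1 : Mat d) v = v := by
  simp [matVec]

lemma inner_matVec_symm {A : Mat d} (hA : A.IsHermitian) (u v : Vec d) :
    ⟪u, matVec A v⟫ = ⟪matVec A u, v⟫ := by
  rw [real_inner_comm v, inner_matVec, inner_matVec, Finset.sum_comm]
  refine Finset.sum_congr rfl fun i _ => Finset.sum_congr rfl fun j _ => ?_
  have h : A j i = A i j := by simpa using hA.apply i j
  rw [h]
  ring

lemma continuous_matVec {X : Type*} [TopologicalSpace X] {A : X → Mat d} {v : X → Vec d}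
    (hA : ∀ i j, Continuous fun x => A x i j) (hv : Continuous v) :
    Continuous fun x => matVec (A x) (v x) := by
  refine (PiLp.continuous_toLp 2 _).comp (continuous_pi fun i => ?_)
  have h : Continuous fun x => ∑ j, A x i j * v x j := continuous_finsetSum _ fun j _ =>
    (hA i j).mul ((EuclideanSpace.proj (𝕜 := ℝ) j).continuous.comp hv)
  exact h

lemma Matrix.PosSemidef.inner_matVec_nonneg {A : Mat d} (hA : A.PosSemidef) (v : Vec d) :
    0 ≤ ⟪v, matVec A v⟫ := by
  have h := hA.dotProduct_mulVec_nonneg (EuclideanSpace.equiv (Fin d) ℝ v)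
  rw [inner_eq_sum]
  simpa [dotProduct, matVec] using h

lemma Matrix.PosDef.inner_matVec_pos {A : Mat d} (hA : A.PosDef) {v : Vec d} (hv : v ≠ 0) :
    0 < ⟪v, matVec A v⟫ := by
  have h := hA.dotProduct_mulVec_pos (x := EuclideanSpace.equiv (Fin d) ℝ v) (by simpa using hv)
  rw [inner_eq_sum]
  simpa [dotProduct, matVec] using h

/-- A positive-definite quadratic form is coercive. -/
lemma Matrix.PosDef.exists_coercive {A : Mat d} (hA : A.PosDef) :
    ∃ c > 0, ∀ v : Vec d, c * ‖v‖ ^ 2 ≤ ⟪v, matVec A v⟫ := by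
  have hcont : Continuous fun v : Vec d => ⟪v, matVec A v⟫ :=
    continuous_id.inner (continuous_matVec (fun _ _ => continuous_const) continuous_id)
  obtain hd | hd := isEmpty_or_nonempty (Fin d)
  · refine ⟨1, one_pos, fun v => ?_⟩
    rw [Subsingleton.elim v 0]
    simp
  obtain ⟨w, hw, hmin⟩ := (isCompact_sphere (0 : Vec d) 1).exists_isMinOn
    (NormedSpace.sphere_nonempty.mpr zero_le_one) hcont.continuousOn
  have hw1 : ‖w‖ = 1 := by simpa using hw
  refine ⟨⟪w, matVec A w⟫, hA.inner_matVec_pos (by rintro rfl; simp at hw1), fun v => ?_⟩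
  obtain rfl | hv := eq_or_ne v 0
  · simp
  have hv' : ‖v‖ ≠ 0 := norm_ne_zero_iff.mpr hv
  have h : ⟪w, matVec A w⟫ ≤ ⟪‖v‖⁻¹ • v, matVec A (‖v‖⁻¹ • v)⟫ :=
    hmin (by simp [norm_smul, hv'])
  rw [matVec_smul, real_inner_smul_left, real_inner_smul_right] at h
  have hp : 0 < ‖v‖ := norm_pos_iff.mpr hv
  calc _ ≤ (‖v‖⁻¹ * (‖v‖⁻¹ * ⟪v, matVec A v⟫)) * ‖v‖ ^ 2 := by gcongr
    _ = _ := by field_simp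

/-- `A` is symmetric with spectrum in `[a, b]`, expressed through its quadratic form. -/
structure IsPinched (a b : ℝ) (A : Mat d) : Prop where
  symm : ∀ u v : Vec d, ⟪u, matVec A v⟫ = ⟪matVec A u, v⟫
  lower : ∀ v : Vec d, a * ‖v‖ ^ 2 ≤ ⟪v, matVec A v⟫
  upper : ∀ v : Vec d, ⟪v, matVec A v⟫ ≤ b * ‖v‖ ^ 2

lemma inner_matVec_smul_one (c : ℝ) (v : Vec d) :
    ⟪v, matVec (c • (1 : Mat d)) v⟫ = c * ‖v‖ ^ 2 := by
  have : matVec (c • (1 : Mat d)) v = c • v := by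
    rw [← matVec_one v]
    ext i
    simp [matVec, Matrix.smul_mulVec]
  rw [this, real_inner_smul_right, real_inner_self_eq_norm_sq]

lemma inner_matVec_sub (A B : Mat d) (u v : Vec d) :
    ⟪u, matVec (A - B) v⟫ = ⟪u, matVec A v⟫ - ⟪u, matVec B v⟫ := by
  simp [inner_matVec, sub_mul, Finset.sum_sub_distrib]

lemma IsPinched.of_posSemidef {a b : ℝ} {A : Mat d} (h₁ : (A - a • 1).PosSemidef)
    (h₂ : (b • (1 : Mat d) - A).PosSemidef) : IsPinched a b A where
  symm := by
    have h : (A - a • 1 + a • (1 : Mat d)).IsHermitian :=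
      h₁.1.add (by simp [Matrix.IsHermitian])
    rw [sub_add_cancel] at h
    exact inner_matVec_symm h
  lower v := by
    have h := h₁.inner_matVec_nonneg v
    rw [inner_matVec_sub, inner_matVec_smul_one] at h
    linarith
  upper v := by
    have h := h₂.inner_matVec_nonneg v
    rw [inner_matVec_sub, inner_matVec_smul_one] at h
    linarith

/-- Weighted Cauchy–Schwarz inequality for the quadratic form of a pinched matrix. -/
lemma IsPinched.two_mul_inner_le {a b : ℝ} {A : Mat d} (hA : IsPinched a b A) (ha : 0 ≤ a)
    {s : ℝ} (hs : 0 < s) (u v : Vec d) :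
    2 * ⟪u, matVec A v⟫ ≤ s * ⟪u, matVec A u⟫ + s⁻¹ * ⟪v, matVec A v⟫ := by
  have h := (mul_nonneg ha (sq_nonneg _)).trans (hA.lower (s • u - v))
  have hsymm : ⟪v, matVec A u⟫ = ⟪u, matVec A v⟫ := by rw [hA.symm, real_inner_comm]
  simp only [matVec_sub, matVec_smul, inner_sub_left, inner_sub_right, real_inner_smul_left,
    real_inner_smul_right, hsymm] at h
  have h' := mul_nonneg (inv_nonneg.mpr hs.le) h
  have : s⁻¹ * (s * (s * ⟪u, matVec A u⟫ - ⟪u, matVec A v⟫) -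
      (s * ⟪u, matVec A v⟫ - ⟪v, matVec A v⟫)) =
      s * ⟪u, matVec A u⟫ + s⁻¹ * ⟪v, matVec A v⟫ - 2 * ⟪u, matVec A v⟫ := by
    field_simp
    ring
  have heq : s * (s * ⟪u, matVec A u⟫) - s * ⟪u, matVec A v⟫ -
      (s * ⟪u, matVec A v⟫ - ⟪v, matVec A v⟫) = s * (s * ⟪u, matVec A u⟫ - ⟪u, matVec A v⟫) -
      (s * ⟪u, matVec A v⟫ - ⟪v, matVec A v⟫) := by ring
  linarith

lemma IsPinched.norm_matVec_sq_le {a b : ℝ} {A : Mat d} (hA : IsPinched a b A) (ha : 0 ≤ a)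
    (hb : 0 < b) (v : Vec d) : ‖matVec A v‖ ^ 2 ≤ b * ⟪v, matVec A v⟫ := by
  have h₁ := hA.two_mul_inner_le ha (inv_pos.mpr hb) (matVec A v) v
  have h₂ := mul_le_mul_of_nonneg_left (hA.upper (matVec A v)) (inv_nonneg.mpr hb.le)
  rw [real_inner_self_eq_norm_sq, inv_inv] at h₁
  rw [inv_mul_cancel_left₀ hb.ne'] at h₂
  linarith

lemma IsPinched.norm_matVec_le {a b : ℝ} {A : Mat d} (hA : IsPinched a b A) (ha : 0 ≤ a)
    (hb : 0 < b) (v : Vec d) : ‖matVec A v‖ ≤ b * ‖v‖ := by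
  refine abs_le_of_sq_le_sq' ?_ (by positivity) |>.2
  calc _ ≤ b * ⟪v, matVec A v⟫ := hA.norm_matVec_sq_le ha hb v
    _ ≤ b * (b * ‖v‖ ^ 2) := by gcongr; exact hA.upper v
    _ = _ := by ring

/-! ### Gradient, Hessian and Bregman divergence -/

lemma inner_gradient (U : Vec d → ℝ) (x v : Vec d) : ⟪gradient U x, v⟫ = fderiv ℝ U x v := by
  simp [gradient]

lemma ContDiff.continuous_gradient {U : Vec d → ℝ} (hU : ContDiff ℝ 2 U) :
    Continuous (gradient U) :=
  (InnerProductSpace.toDual ℝ (Vec d)).symm.continuous.comp (hU.continuous_fderiv (by norm_num))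

lemma ContDiff.fderiv_apply_const {U : Vec d → ℝ} (hU : ContDiff ℝ 2 U) (w : Vec d) :
    ContDiff ℝ 1 fun x => fderiv ℝ U x w :=
  (hU.fderiv_right (m := 1) (by norm_num)).clm_apply contDiff_const

lemma ContDiff.continuous_hess {U : Vec d → ℝ} (hU : ContDiff ℝ 2 U) (i j : Fin d) :
    Continuous fun x => hess U x i j :=
  ((hU.fderiv_apply_const _).continuous_fderiv (by norm_num)).clm_apply continuous_const

lemma vec_eq_sum (v : Vec d) : v = ∑ i, v i • EuclideanSpace.single i (1 : ℝ) := by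
  ext i
  simp [Pi.single_apply]

lemma ContDiff.fderiv_fderiv_apply {U : Vec d → ℝ} (hU : ContDiff ℝ 2 U) (x v w : Vec d) :
    fderiv ℝ (fun y => fderiv ℝ U y w) x v = ⟪v, matVec (hess U x) w⟫ := by
  have hd : ∀ u, Differentiable ℝ fun y => fderiv ℝ U y u := fun u =>
    (hU.fderiv_apply_const u).differentiable (by norm_num)
  have hw : (fun y => fderiv ℝ U y w) =
      fun y => ∑ j, w j * fderiv ℝ U y (EuclideanSpace.single j 1) := by
    ext y
    conv_lhs => rw [vec_eq_sum w]
    simp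
  have h : HasFDerivAt (fun y => ∑ j, w j * fderiv ℝ U y (EuclideanSpace.single j 1))
      (∑ j, w j • fderiv ℝ (fun y => fderiv ℝ U y (EuclideanSpace.single j 1)) x) x :=
    HasFDerivAt.fun_sum fun j _ => ((hd _ x).hasFDerivAt.const_mul (w j))
  rw [hw, h.fderiv, inner_matVec]
  conv_lhs => rw [vec_eq_sum v]
  simp only [map_sum, map_smul, _root_.sum_apply, _root_.smul_apply,
    smul_eq_mul, Finset.mul_sum]
  refine Finset.sum_congr rfl fun i _ => Finset.sum_congr rfl fun j _ => ?_
  simp only [hess, Matrix.of_apply]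
  ring

lemma hasDerivAt_line (y v : Vec d) (t : ℝ) : HasDerivAt (fun t : ℝ => y + t • v) v t := by
  simpa using ((hasDerivAt_id t).smul_const v).const_add y

lemma add_half_le_of_le_deriv {f f' f'' : ℝ → ℝ} {c : ℝ} (hf : ∀ t, HasDerivAt f (f' t) t)
    (hf' : ∀ t, HasDerivAt f' (f'' t) t) (hc : ∀ t, c ≤ f'' t) : f 0 + f' 0 + c / 2 ≤ f 1 := by
  have hmono : Monotone fun t => f' t - c * t :=
    monotone_of_hasDerivAt_nonneg (f' := fun t => f'' t - c)
      (fun t => by convert! (hf' t).sub ((hasDerivAt_id t).const_mul c) using 1; simp)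
      fun t => by simpa using hc t
  have hg : ∀ t, HasDerivAt (fun t => f t - f' 0 * t - c / 2 * t ^ 2) (f' t - f' 0 - c * t) t := by
    intro t
    convert! ((hf t).sub ((hasDerivAt_id t).const_mul (f' 0))).sub
      ((hasDerivAt_pow 2 t).const_mul (c / 2)) using 1
    simp
    ring
  have hmono' : MonotoneOn (fun t => f t - f' 0 * t - c / 2 * t ^ 2) (Set.Icc 0 1) := by
    refine monotoneOn_of_deriv_nonneg (convex_Icc 0 1)
      (fun t _ => (hg t).continuousAt.continuousWithinAt)
      (fun t _ => (hg t).differentiableAt.differentiableWithinAt) fun t ht => ?_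
    rw [interior_Icc] at ht
    rw [(hg t).deriv]
    have := hmono ht.1.le
    simp only [mul_zero] at this
    linarith
  have := hmono' (Set.left_mem_Icc.mpr zero_le_one) (Set.right_mem_Icc.mpr zero_le_one) zero_le_one
  simp only at this
  linarith

lemma ContDiff.hasDerivAt_line {U : Vec d → ℝ} (hU : ContDiff ℝ 2 U) (y v : Vec d) (t : ℝ) :
    HasDerivAt (fun t : ℝ => U (y + t • v)) (fderiv ℝ U (y + t • v) v) t :=
  ((hU.differentiable (by norm_num) _).hasFDerivAt).comp_hasDerivAt t (_root_.hasDerivAt_line y v t)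

lemma ContDiff.hasDerivAt_fderiv_line {U : Vec d → ℝ} (hU : ContDiff ℝ 2 U) (y v : Vec d) (t : ℝ) :
    HasDerivAt (fun t : ℝ => fderiv ℝ U (y + t • v) v) ⟪v, matVec (hess U (y + t • v)) v⟫ t := by
  rw [← hU.fderiv_fderiv_apply]
  exact (((hU.fderiv_apply_const v).differentiable (by norm_num) _).hasFDerivAt).comp_hasDerivAt t
    (_root_.hasDerivAt_line y v t)

section Pinched

variable {U : Vec d → ℝ} {μ L : ℝ}

lemma mul_norm_sq_le_bregman (hU : ContDiff ℝ 2 U) (hH : ∀ x, IsPinched μ L (hess U x))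
    (x y : Vec d) : μ / 2 * ‖x - y‖ ^ 2 ≤ bregman U x y := by
  have h := add_half_le_of_le_deriv (hU.hasDerivAt_line y (x - y))
    (hU.hasDerivAt_fderiv_line y (x - y)) fun t => (hH _).lower (x - y)
  simp only [zero_smul, add_zero, one_smul, add_sub_cancel] at h
  rw [bregman, inner_gradient]
  linarith

lemma bregman_le_mul_norm_sq (hU : ContDiff ℝ 2 U) (hH : ∀ x, IsPinched μ L (hess U x))
    (x y : Vec d) : bregman U x y ≤ L / 2 * ‖x - y‖ ^ 2 := by
  have h := add_half_le_of_le_deriv (fun t => (hU.hasDerivAt_line y (x - y) t).neg)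
    (fun t => (hU.hasDerivAt_fderiv_line y (x - y) t).neg)
    fun t => neg_le_neg ((hH _).upper (x - y))
  simp only [Pi.neg_apply, zero_smul, add_zero, one_smul, add_sub_cancel] at h
  rw [bregman, inner_gradient]
  linarith

lemma norm_gradient_sub_sq_le_bregman (hU : ContDiff ℝ 2 U)
    (hH : ∀ x, IsPinched μ L (hess U x)) (hμ : 0 ≤ μ) (hL : 0 < L) (x y : Vec d) :
    ‖gradient U x - gradient U y‖ ^ 2 ≤ 2 * L * bregman U x y := by
  set w := gradient U x - gradient U y with hw
  have h₁ := (mul_nonneg (div_nonneg hμ zero_le_two) (sq_nonneg _)).trans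
    (mul_norm_sq_le_bregman hU hH (x - L⁻¹ • w) y)
  have h₂ := bregman_le_mul_norm_sq hU hH (x - L⁻¹ • w) x
  have h₃ : bregman U (x - L⁻¹ • w) y =
      bregman U (x - L⁻¹ • w) x + bregman U x y - L⁻¹ * ‖w‖ ^ 2 := by
    have : L⁻¹ * ‖w‖ ^ 2 = L⁻¹ * (⟪gradient U x, w⟫ - ⟪gradient U y, w⟫) := by
      rw [← inner_sub_left, ← hw, real_inner_self_eq_norm_sq]
    rw [this]
    simp only [bregman, inner_sub_right, real_inner_smul_right]
    ring
  have h₄ : ‖x - L⁻¹ • w - x‖ ^ 2 = L⁻¹ ^ 2 * ‖w‖ ^ 2 := by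
    rw [sub_sub_cancel_left, norm_neg, norm_smul, mul_pow, Real.norm_eq_abs, sq_abs]
  rw [h₄] at h₂
  have h₅ : L / 2 * (L⁻¹ ^ 2 * ‖w‖ ^ 2) = L⁻¹ * ‖w‖ ^ 2 / 2 := by field_simp
  have h₆ : L⁻¹ * ‖w‖ ^ 2 ≤ 2 * bregman U x y := by linarith
  calc ‖w‖ ^ 2 = L * (L⁻¹ * ‖w‖ ^ 2) := by field_simp
    _ ≤ L * (2 * bregman U x y) := by gcongr
    _ = _ := by ring

lemma norm_gradient_sub_sq_le_inner (hU : ContDiff ℝ 2 U)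
    (hH : ∀ x, IsPinched μ L (hess U x)) (hμ : 0 ≤ μ) (hL : 0 < L) (x y : Vec d) :
    ‖gradient U x - gradient U y‖ ^ 2 ≤ L * ⟪gradient U x - gradient U y, x - y⟫ := by
  have h₁ := norm_gradient_sub_sq_le_bregman hU hH hμ hL x y
  have h₂ := norm_gradient_sub_sq_le_bregman hU hH hμ hL y x
  rw [norm_sub_rev] at h₂
  have h₃ : bregman U x y + bregman U y x = ⟪gradient U x - gradient U y, x - y⟫ := by
    simp only [bregman, inner_sub_left, inner_sub_right]
    ring
  rw [← h₃]
  linarith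

lemma norm_gradient_sub_le (hU : ContDiff ℝ 2 U)
    (hH : ∀ x, IsPinched μ L (hess U x)) (hμ : 0 ≤ μ) (hL : 0 < L) (x y : Vec d) :
    ‖gradient U x - gradient U y‖ ≤ L * ‖x - y‖ := by
  refine abs_le_of_sq_le_sq' ?_ (by positivity) |>.2
  have h₁ := norm_gradient_sub_sq_le_bregman hU hH hμ hL x y
  have h₂ := bregman_le_mul_norm_sq hU hH x y
  calc _ ≤ 2 * L * (L / 2 * ‖x - y‖ ^ 2) := h₁.trans (by gcongr)
    _ = _ := by ring

end Pinched

/-! ### Gaussian integrals -/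

/-- The Lebesgue density of `gaussian m S`. -/
def gaussianDensity (m : Vec d) (S : Mat d) (x : Vec d) : ℝ :=
  Real.sqrt (((2 * π) ^ d * S.det)⁻¹) * Real.exp (-⟪x - m, matVec S⁻¹ (x - m)⟫ / 2)

lemma gaussianDensity_nonneg (m : Vec d) (S : Mat d) (x : Vec d) : 0 ≤ gaussianDensity m S x :=
  mul_nonneg (Real.sqrt_nonneg _) (Real.exp_pos _).le

lemma continuous_gaussianDensity (m : Vec d) (S : Mat d) : Continuous (gaussianDensity m S) := by
  have h : Continuous fun x : Vec d => x - m := continuous_id.sub continuous_const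
  have hq : Continuous fun x : Vec d => ⟪x - m, matVec S⁻¹ (x - m)⟫ :=
    h.inner (continuous_matVec (fun _ _ => continuous_const) h)
  unfold gaussianDensity
  fun_prop

lemma isLinearMap_matVec (A : Mat d) : IsLinearMap ℝ (matVec A) :=
  ⟨matVec_add A, matVec_smul A⟩

/-- `matVec A` as a continuous linear map. -/
def matVecCLM (A : Mat d) : Vec d →L[ℝ] Vec d :=
  LinearMap.toContinuousLinearMap (isLinearMap_matVec A).mk'

lemma hasFDerivAt_gaussianDensity (m : Vec d) {S : Mat d} (hS : S.PosDef) (x : Vec d) :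
    HasFDerivAt (gaussianDensity m S)
      (-gaussianDensity m S x • innerSL ℝ (matVec S⁻¹ (x - m))) x := by
  have hid : HasFDerivAt (fun y : Vec d => y - m) (ContinuousLinearMap.id ℝ (Vec d)) x :=
    (hasFDerivAt_id x).sub_const m
  have hlin : HasFDerivAt (fun y : Vec d => matVec S⁻¹ (y - m)) (matVecCLM S⁻¹) x :=
    (matVecCLM S⁻¹).hasFDerivAt.comp x hid
  have h := (((hid.inner ℝ hlin).const_mul (-1 / 2)).exp).const_mul
    (Real.sqrt (((2 * π) ^ d * S.det)⁻¹))
  convert! h using 1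
  · ext y
    simp only [gaussianDensity]
    congr 2
    ring
  · ext v
    have hs : ⟪x - m, matVecCLM S⁻¹ v⟫ = ⟪matVec S⁻¹ (x - m), v⟫ :=
      inner_matVec_symm hS.inv.1 _ _
    have hc : ⟪v, matVec S⁻¹ (x - m)⟫ = ⟪matVec S⁻¹ (x - m), v⟫ := real_inner_comm _ _
    have he : -⟪x - m, matVec S⁻¹ (x - m)⟫ / 2 = -1 / 2 * ⟪x - m, matVec S⁻¹ (x - m)⟫ := by ring
    simp [gaussianDensity, fderivInnerCLM_apply, hs, hc, he]
    ring

lemma integrable_exp_neg_mul_norm_sub_sq {c : ℝ} (hc : 0 < c) (m : Vec d) :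
    Integrable fun x : Vec d => Real.exp (-c * ‖x - m‖ ^ 2) := by
  have h := (GaussianFourier.integrable_cexp_neg_mul_sq_norm_add (V := Vec d) (b := (c : ℂ))
    (by simpa using hc) 0 0).re
  refine (h.comp_sub_right m).congr (Filter.Eventually.of_forall fun x => ?_)
  simp only [zero_mul, add_zero, RCLike.re_eq_complex_re]
  rw [← Complex.ofReal_re (Real.exp _)]
  push_cast
  rfl

lemma one_add_norm_sq_mul_exp_le {c : ℝ} (hc : 0 < c) (m x : Vec d) :
    (1 + ‖x‖ ^ 2) * Real.exp (-(2 * c) * ‖x - m‖ ^ 2) ≤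
      (1 + 2 * ‖m‖ ^ 2 + 2 / c) * Real.exp (-c * ‖x - m‖ ^ 2) := by
  have h₁ : ‖x‖ ^ 2 ≤ 2 * ‖m‖ ^ 2 + 2 * ‖x - m‖ ^ 2 := by
    have : ‖x‖ ≤ ‖m‖ + ‖x - m‖ := by simpa using norm_add_le m (x - m)
    nlinarith [norm_nonneg x, sq_nonneg (‖m‖ - ‖x - m‖)]
  set t := ‖x - m‖ ^ 2 with ht
  have ht0 : 0 ≤ t := sq_nonneg _
  have h₂ : c * t + 1 ≤ Real.exp (c * t) := Real.add_one_le_exp _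
  have h₃ : t ≤ 1 / c * Real.exp (c * t) := by
    rw [div_mul_eq_mul_div, le_div_iff₀ hc]
    linarith
  have h₄ : 1 ≤ Real.exp (c * t) := by nlinarith
  have h₅ : 1 + ‖x‖ ^ 2 ≤ (1 + 2 * ‖m‖ ^ 2 + 2 / c) * Real.exp (c * t) := by
    have : (1 + 2 * ‖m‖ ^ 2) * 1 ≤ (1 + 2 * ‖m‖ ^ 2) * Real.exp (c * t) := by gcongr
    calc 1 + ‖x‖ ^ 2 ≤ (1 + 2 * ‖m‖ ^ 2) * 1 + 2 * t := by linarith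
      _ ≤ (1 + 2 * ‖m‖ ^ 2) * Real.exp (c * t) + 2 * (1 / c * Real.exp (c * t)) := by gcongr
      _ = _ := by ring
  calc _ ≤ (1 + 2 * ‖m‖ ^ 2 + 2 / c) * Real.exp (c * t) * Real.exp (-(2 * c) * t) := by gcongr
    _ = _ := by
      rw [mul_assoc, ← Real.exp_add]
      ring_nf

lemma integrable_one_add_norm_sq_mul_gaussianDensity (m : Vec d) {S : Mat d} (hS : S.PosDef) :
    Integrable fun x : Vec d => (1 + ‖x‖ ^ 2) * gaussianDensity m S x := by
  obtain ⟨c, hc, hle⟩ := hS.inv.exists_coercive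
  have h := ((integrable_exp_neg_mul_norm_sub_sq (c := c / 4) (by positivity) m).const_mul
    (1 + 2 * ‖m‖ ^ 2 + 2 / (c / 4))).const_mul (Real.sqrt (((2 * π) ^ d * S.det)⁻¹))
  refine h.mono' ?_ (Filter.Eventually.of_forall fun x => ?_)
  · exact ((continuous_const.add (continuous_norm.pow 2)).mul
      (continuous_gaussianDensity m S)).aestronglyMeasurable
  rw [Real.norm_of_nonneg (mul_nonneg (by positivity) (gaussianDensity_nonneg m S x)),
    gaussianDensity, mul_left_comm]
  refine mul_le_mul_of_nonneg_left ?_ (Real.sqrt_nonneg _)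
  refine le_trans ?_ (one_add_norm_sq_mul_exp_le (c := c / 4) (by positivity) m x)
  gcongr
  linarith [hle (x - m)]

lemma gaussian_eq_withDensity (m : Vec d) (S : Mat d) :
    gaussian m S = volume.withDensity fun x => ENNReal.ofReal (gaussianDensity m S x) := rfl

lemma integrable_gaussian_iff {E : Type*} [NormedAddCommGroup E] [NormedSpace ℝ E] (m : Vec d)
    (S : Mat d) (f : Vec d → E) :
    Integrable f (gaussian m S) ↔ Integrable fun x => gaussianDensity m S x • f x := by
  rw [gaussian_eq_withDensity, integrable_withDensity_iff_integrable_smul'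
    (continuous_gaussianDensity m S).measurable.ennreal_ofReal
    (Filter.Eventually.of_forall fun x => ENNReal.ofReal_lt_top)]
  simp only [ENNReal.toReal_ofReal (gaussianDensity_nonneg m S _)]

lemma integral_gaussian_eq {E : Type*} [NormedAddCommGroup E] [NormedSpace ℝ E] (m : Vec d)
    (S : Mat d) (f : Vec d → E) :
    ∫ x, f x ∂gaussian m S = ∫ x, gaussianDensity m S x • f x := by
  rw [gaussian_eq_withDensity, integral_withDensity_eq_integral_toReal_smul
    (continuous_gaussianDensity m S).measurable.ennreal_ofReal
    (Filter.Eventually.of_forall fun x => ENNReal.ofReal_lt_top)]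
  simp only [ENNReal.toReal_ofReal (gaussianDensity_nonneg m S _)]

/-- Continuous functions of at most quadratic growth are Gaussian-integrable. -/
lemma integrable_gaussian_of_le {E : Type*} [NormedAddCommGroup E] [NormedSpace ℝ E]
    (m : Vec d) {S : Mat d} (hS : S.PosDef) {f : Vec d → E} (hf : Continuous f) (C : ℝ)
    (hC : ∀ x, ‖f x‖ ≤ C * (1 + ‖x‖ ^ 2)) : Integrable f (gaussian m S) := by
  rw [integrable_gaussian_iff]
  refine ((integrable_one_add_norm_sq_mul_gaussianDensity m hS).const_mul C).mono'
    ((continuous_gaussianDensity m S).smul hf).aestronglyMeasurable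
    (Filter.Eventually.of_forall fun x => ?_)
  rw [norm_smul, Real.norm_of_nonneg (gaussianDensity_nonneg m S x), ← mul_assoc, mul_comm]
  exact mul_le_mul_of_nonneg_right (hC x) (gaussianDensity_nonneg m S x)

/-- A continuous function of at most linear growth has Gaussian-integrable square. -/
lemma integrable_gaussian_norm_sq (m : Vec d) {S : Mat d} (hS : S.PosDef) {E : Type*}
    [NormedAddCommGroup E] {f : Vec d → E} (hf : Continuous f) (a b : ℝ)
    (hab : ∀ x, ‖f x‖ ≤ a + b * ‖x‖) : Integrable (fun x => ‖f x‖ ^ 2) (gaussian m S) := by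
  refine integrable_gaussian_of_le m hS (hf.norm.pow 2) (2 * a ^ 2 + 2 * b ^ 2) fun x => ?_
  rw [norm_pow, norm_norm]
  nlinarith [hab x, norm_nonneg (f x), sq_nonneg (a - b * ‖x‖), sq_nonneg (a * ‖x‖), sq_nonneg b,
    mul_self_le_mul_self (norm_nonneg (f x)) (hab x)]

lemma integrable_gaussian_inner (m : Vec d) {S : Mat d} (hS : S.PosDef) {f g : Vec d → Vec d}
    (hf : Continuous f) (hg : Continuous g) (a b a' b' : ℝ) (hab : ∀ x, ‖f x‖ ≤ a + b * ‖x‖)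
    (hab' : ∀ x, ‖g x‖ ≤ a' + b' * ‖x‖) : Integrable (fun x => ⟪f x, g x⟫) (gaussian m S) := by
  refine ((integrable_gaussian_norm_sq m hS hf a b hab).add
    (integrable_gaussian_norm_sq m hS hg a' b' hab')).mono' (hf.inner hg).aestronglyMeasurable
    (Filter.Eventually.of_forall fun x => ?_)
  refine (norm_inner_le_norm _ _).trans ?_
  simp only [Pi.add_apply]
  nlinarith [sq_nonneg (‖f x‖ - ‖g x‖), sq_nonneg (‖f x‖), sq_nonneg (‖g x‖)]

lemma integrable_gaussian_mul_inner (m : Vec d) {S : Mat d} (hS : S.PosDef) {f : Vec d → ℝ}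
    (hf : Continuous f) (v : Vec d) (a b : ℝ) (hab : ∀ x, |f x| ≤ a + b * ‖x‖) :
    Integrable (fun x => f x * ⟪matVec S⁻¹ (x - m), v⟫) (gaussian m S) := by
  have hlin : Continuous fun x : Vec d => matVec S⁻¹ (x - m) :=
    continuous_matVec (fun _ _ => continuous_const) (continuous_id.sub continuous_const)
  have h := integrable_gaussian_inner m hS (hlin : Continuous fun x => matVec S⁻¹ (x - m))
    (g := fun x => f x • v) (hf.smul continuous_const) (‖matVecCLM S⁻¹‖ * ‖m‖) ‖matVecCLM S⁻¹‖
    (a * ‖v‖)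
    (b * ‖v‖) (fun x => ?_) fun x => ?_
  · simpa only [real_inner_smul_right] using h
  · calc ‖matVecCLM S⁻¹ (x - m)‖ ≤ ‖matVecCLM S⁻¹‖ * ‖x - m‖ := (matVecCLM S⁻¹).le_opNorm _
      _ ≤ ‖matVecCLM S⁻¹‖ * (‖x‖ + ‖m‖) := by gcongr; exact norm_sub_le x m
      _ = _ := by ring
  · rw [norm_smul, Real.norm_eq_abs]
    calc _ ≤ (a + b * ‖x‖) * ‖v‖ := by gcongr; exact hab x
      _ = _ := by ring

lemma integrable_gaussian_of_le_linear {E : Type*} [NormedAddCommGroup E] [NormedSpace ℝ E]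
    (m : Vec d) {S : Mat d} (hS : S.PosDef) {f : Vec d → E} (hf : Continuous f) (a b : ℝ)
    (hab : ∀ x, ‖f x‖ ≤ a + b * ‖x‖) : Integrable f (gaussian m S) := by
  refine integrable_gaussian_of_le m hS hf (|a| + |b|) fun x => (hab x).trans ?_
  have h₁ := le_abs_self a
  have h₂ : b * ‖x‖ ≤ |b| * ‖x‖ := by gcongr; exact le_abs_self b
  have h₃ : ‖x‖ ≤ 1 + ‖x‖ ^ 2 := by nlinarith [sq_nonneg (‖x‖ - 1), norm_nonneg x]
  have h₄ : |b| * ‖x‖ ≤ |b| * (1 + ‖x‖ ^ 2) := by gcongr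
  nlinarith [mul_nonneg (abs_nonneg a) (sq_nonneg ‖x‖)]

/-- Gaussian integration by parts. -/
lemma integral_gaussian_fderiv (m : Vec d) {S : Mat d} (hS : S.PosDef) {f : Vec d → ℝ}
    (hf : ContDiff ℝ 1 f) (v : Vec d) (a b c : ℝ) (hab : ∀ x, |f x| ≤ a + b * ‖x‖)
    (hc : ∀ x, |fderiv ℝ f x v| ≤ c) :
    ∫ x, fderiv ℝ f x v ∂gaussian m S = ∫ x, f x * ⟪matVec S⁻¹ (x - m), v⟫ ∂gaussian m S := by
  have hρ' : ∀ x, fderiv ℝ (gaussianDensity m S) x v =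
      -(gaussianDensity m S x * ⟪matVec S⁻¹ (x - m), v⟫) := fun x => by
    rw [(hasFDerivAt_gaussianDensity m hS x).fderiv, neg_smul, _root_.neg_apply,
      _root_.smul_apply, innerSL_apply_apply, smul_eq_mul]
  have hi₁ := (integrable_gaussian_iff m S _).mp <| integrable_gaussian_of_le_linear m hS
    ((hf.continuous_fderiv (by norm_num)).clm_apply (continuous_const (y := v))) c 0
    (by simpa using hc)
  have hi₂ := (integrable_gaussian_iff m S _).mp <|
    integrable_gaussian_mul_inner m hS hf.continuous v a b hab
  have hi₃ := (integrable_gaussian_iff m S _).mp <|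
    integrable_gaussian_of_le_linear m hS hf.continuous a b hab
  simp only [smul_eq_mul] at hi₁ hi₂ hi₃
  have h := integral_mul_fderiv_eq_neg_fderiv_mul_of_integrable (μ := (volume : Measure (Vec d)))
    (f := gaussianDensity m S) (g := f) (v := v)
    (hi₂.neg.congr (Filter.Eventually.of_forall fun x => by
      simp only [hρ', Pi.neg_apply]; ring)) hi₁ hi₃
    (fun x _ => (hasFDerivAt_gaussianDensity m hS x).differentiableAt)
    fun x _ => hf.differentiable (by norm_num) x
  rw [integral_gaussian_eq, integral_gaussian_eq]
  simp only [smul_eq_mul]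
  rw [h, ← integral_neg]
  congr 1
  ext x
  rw [hρ']
  ring

lemma integral_gaussian_fderiv_col (m : Vec d) {S : Mat d} (hS : S.PosDef) {f : Vec d → ℝ}
    (hf : ContDiff ℝ 1 f) (i : Fin d) (a b c : ℝ) (hab : ∀ x, |f x| ≤ a + b * ‖x‖)
    (hc : ∀ x, |fderiv ℝ f x (matVec S (EuclideanSpace.single i 1))| ≤ c) :
    ∫ x, fderiv ℝ f x (matVec S (EuclideanSpace.single i 1)) ∂gaussian m S =
      ∫ x, f x * (x i - m i) ∂gaussian m S := by
  rw [integral_gaussian_fderiv m hS hf _ a b c hab hc]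
  have hunit : IsUnit S.det := hS.isUnit.map Matrix.detMonoidHom
  refine integral_congr_ae (Filter.Eventually.of_forall fun x => ?_)
  simp only
  rw [← inner_matVec_symm hS.inv.1, ← matVec_mul, Matrix.nonsing_inv_mul _ hunit, matVec_one,
    inner_single_one, PiLp.sub_apply]

lemma integral_gaussian_sub_apply (m : Vec d) {S : Mat d} (hS : S.PosDef) (i : Fin d) :
    ∫ x, (x i - m i) ∂gaussian m S = 0 := by
  have h := integral_gaussian_fderiv_col m hS (f := fun _ => (1 : ℝ)) contDiff_const i 1 0 0
    (by simp) (by simp)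
  simpa using h.symm

lemma integrable_gaussian_id (m : Vec d) {S : Mat d} (hS : S.PosDef) :
    Integrable (fun x => x - m) (gaussian m S) :=
  integrable_gaussian_of_le_linear m hS (continuous_id.sub continuous_const) ‖m‖ 1 fun x => by
    linarith [norm_sub_le x m]

lemma integral_gaussian_sub (m : Vec d) {S : Mat d} (hS : S.PosDef) :
    ∫ x, (x - m) ∂gaussian m S = 0 := by
  ext i
  have h := (EuclideanSpace.proj (𝕜 := ℝ) i).integral_comp_comm (integrable_gaussian_id m hS)
  refine Eq.trans h.symm ?_
  simpa using integral_gaussian_sub_apply m hS i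

lemma integral_gaussian_inner_sub (m : Vec d) {S : Mat d} (hS : S.PosDef) (v : Vec d) :
    ∫ x, ⟪v, x - m⟫ ∂gaussian m S = 0 := by
  rw [integral_inner (integrable_gaussian_id m hS), integral_gaussian_sub m hS, inner_zero_right]

lemma integral_gaussian_cov (m : Vec d) {S : Mat d} (hS : S.PosDef)
    [IsProbabilityMeasure (gaussian m S)] (i j : Fin d) :
    ∫ x, (x i - m i) * (x j - m j) ∂gaussian m S = S i j := by
  have hd : ∀ x : Vec d, HasFDerivAt (fun x : Vec d => x i - m i)
      (EuclideanSpace.proj (𝕜 := ℝ) i) x := fun x =>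
    (EuclideanSpace.proj (𝕜 := ℝ) i).hasFDerivAt.sub_const (m i)
  have hS' : ∀ x, fderiv ℝ (fun x : Vec d => x i - m i) x
      (matVec S (EuclideanSpace.single j 1)) = S i j := fun x => by
    rw [(hd x).fderiv]
    simp [matVec_apply]
  have h := integral_gaussian_fderiv_col m hS (f := fun x => x i - m i)
    ((EuclideanSpace.proj (𝕜 := ℝ) i).contDiff.sub contDiff_const) j ‖m‖ 1 |S i j|
    (fun x => by
      have h₁ := PiLp.norm_apply_le x i
      have h₂ := PiLp.norm_apply_le m i
      rw [Real.norm_eq_abs] at h₁ h₂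
      linarith [abs_sub (x i) (m i)])
    fun x => (congrArg abs (hS' x)).le
  rw [← h]
  simp [hS']

/-- The expectation of a quadratic form of a centred Gaussian. -/
lemma integral_gaussian_inner_matVec (m : Vec d) {S : Mat d} (hS : S.PosDef)
    [IsProbabilityMeasure (gaussian m S)] (A : Mat d) :
    ∫ x, ⟪x - m, matVec A (x - m)⟫ ∂gaussian m S = ∑ i, ∑ j, A i j * S i j := by
  have hi : ∀ i j, Integrable (fun x => A i j * ((x i - m i) * (x j - m j))) (gaussian m S) := by
    intro i j
    have hb : ∀ (k : Fin d) (x : Vec d), |x k - m k| ≤ ‖x‖ + ‖m‖ := fun k x =>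
      (PiLp.norm_apply_le (x - m) k).trans (norm_sub_le x m)
    refine Integrable.const_mul (integrable_gaussian_of_le m hS ?_ (2 + 2 * ‖m‖ ^ 2) fun x => ?_) _
    · fun_prop
    · rw [norm_mul, Real.norm_eq_abs, Real.norm_eq_abs]
      calc _ ≤ (‖x‖ + ‖m‖) * (‖x‖ + ‖m‖) := by
            gcongr
            exacts [hb i x, hb j x]
        _ ≤ _ := by nlinarith [sq_nonneg (‖x‖ - ‖m‖), sq_nonneg (‖x‖ * ‖m‖)]
  simp only [inner_matVec, PiLp.sub_apply]
  rw [integral_finsetSum _ fun i _ => integrable_finsetSum _ fun j _ => hi i j]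
  refine Finset.sum_congr rfl fun i _ => ?_
  rw [integral_finsetSum _ fun j _ => hi i j]
  refine Finset.sum_congr rfl fun j _ => ?_
  rw [integral_const_mul, integral_gaussian_cov m hS]

lemma integral_gaussian_inner_inv (m : Vec d) {S : Mat d} (hS : S.PosDef)
    [IsProbabilityMeasure (gaussian m S)] :
    ∫ x, ⟪x - m, matVec S⁻¹ (x - m)⟫ ∂gaussian m S = d := by
  have hunit : IsUnit S.det := hS.isUnit.map Matrix.detMonoidHom
  have h : (S⁻¹ * S).trace = (d : ℝ) := by
    rw [Matrix.nonsing_inv_mul _ hunit, Matrix.trace_one, Fintype.card_fin]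
  rw [integral_gaussian_inner_matVec m hS, ← h, Matrix.trace]
  refine Finset.sum_congr rfl fun i _ => Finset.sum_congr rfl fun j _ => ?_
  have : S i j = S j i := by simpa using (hS.1.apply i j).symm
  rw [this]

section Pinched

variable {U : Vec d → ℝ} {μ L : ℝ}

lemma norm_gradient_le (hU : ContDiff ℝ 2 U) (hH : ∀ x, IsPinched μ L (hess U x)) (hμ : 0 ≤ μ)
    (hL : 0 < L) (x : Vec d) : ‖gradient U x‖ ≤ ‖gradient U 0‖ + L * ‖x‖ := by
  have h₁ := norm_gradient_sub_le hU hH hμ hL x 0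
  have h₂ := norm_sub_norm_le (gradient U x) (gradient U 0)
  rw [sub_zero] at h₁
  linarith

lemma integrable_hess (hU : ContDiff ℝ 2 U) (hH : ∀ x, IsPinched μ L (hess U x)) (hμ : 0 ≤ μ)
    (hL : 0 < L) (m : Vec d) {S : Mat d} (hS : S.PosDef) (i j : Fin d) :
    Integrable (fun x => hess U x i j) (gaussian m S) := by
  refine integrable_gaussian_of_le m hS (hU.continuous_hess i j) L fun x => ?_
  have h₁ := PiLp.norm_apply_le (matVec (hess U x) (EuclideanSpace.single j 1)) i
  have h₂ := (hH x).norm_matVec_le hμ hL (EuclideanSpace.single j 1)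
  have h₃ : matVec (hess U x) (EuclideanSpace.single j 1) i = hess U x i j := by
    simp [matVec_apply]
  rw [h₃] at h₁
  simp only [PiLp.norm_single, norm_one, mul_one] at h₂
  nlinarith [mul_nonneg hL.le (sq_nonneg ‖x‖)]

lemma inner_matVec_intHess (hU : ContDiff ℝ 2 U) (hH : ∀ x, IsPinched μ L (hess U x))
    (hμ : 0 ≤ μ) (hL : 0 < L) (m : Vec d) {S : Mat d} (hS : S.PosDef) (u v : Vec d) :
    ⟪u, matVec (intHess U (gaussian m S)) v⟫ = ∫ x, ⟪u, matVec (hess U x) v⟫ ∂gaussian m S := by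
  have hi := integrable_hess hU hH hμ hL m hS
  simp only [inner_matVec]
  rw [integral_finsetSum _ fun i _ => integrable_finsetSum _ fun j _ => (hi i j).mul_const _]
  refine Finset.sum_congr rfl fun i _ => ?_
  rw [integral_finsetSum _ fun j _ => (hi i j).mul_const _]
  refine Finset.sum_congr rfl fun j _ => ?_
  rw [integral_mul_const]
  rfl

lemma isPinched_intHess (hU : ContDiff ℝ 2 U) (hH : ∀ x, IsPinched μ L (hess U x))
    (hμ : 0 ≤ μ) (hL : 0 < L) (m : Vec d) {S : Mat d} (hS : S.PosDef)
    [IsProbabilityMeasure (gaussian m S)] : IsPinched μ L (intHess U (gaussian m S)) := by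
  have key := inner_matVec_intHess hU hH hμ hL m hS
  have hint : ∀ v : Vec d, Integrable (fun x => ⟪v, matVec (hess U x) v⟫) (gaussian m S) := by
    intro v
    simp only [inner_matVec]
    exact integrable_finsetSum _ fun i _ => integrable_finsetSum _ fun j _ =>
      (integrable_hess hU hH hμ hL m hS i j).mul_const _
  refine ⟨fun u v => ?_, fun v => ?_, fun v => ?_⟩
  · rw [key, real_inner_comm, key]
    refine integral_congr_ae (Filter.Eventually.of_forall fun x => ?_)
    simp only
    rw [(hH x).symm, real_inner_comm]
  · rw [key]
    calc μ * ‖v‖ ^ 2 = ∫ _, μ * ‖v‖ ^ 2 ∂gaussian m S := by simp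
      _ ≤ _ := integral_mono (integrable_const _) (hint v) fun x => (hH x).lower v
  · rw [key]
    calc _ ≤ ∫ _, L * ‖v‖ ^ 2 ∂gaussian m S :=
          integral_mono (hint v) (integrable_const _) fun x => (hH x).upper v
      _ = _ := by simp

lemma integrable_gradient (hU : ContDiff ℝ 2 U) (hH : ∀ x, IsPinched μ L (hess U x))
    (hμ : 0 ≤ μ) (hL : 0 < L) (m : Vec d) {S : Mat d} (hS : S.PosDef) :
    Integrable (gradient U) (gaussian m S) :=
  integrable_gaussian_of_le_linear m hS hU.continuous_gradient _ _ (norm_gradient_le hU hH hμ hL)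

/-- **Stein's identity** in gradient form. -/
lemma integral_gaussian_inner_gradient (hU : ContDiff ℝ 2 U)
    (hH : ∀ x, IsPinched μ L (hess U x)) (hμ : 0 ≤ μ) (hL : 0 < L) (m : Vec d) {S : Mat d}
    (hS : S.PosDef) [IsProbabilityMeasure (gaussian m S)] :
    ∫ x, ⟪gradient U x, x - m⟫ ∂gaussian m S =
      ∫ x, ⟪x - m, matVec (intHess U (gaussian m S)) (x - m)⟫ ∂gaussian m S := by
  have hi := integrable_hess hU hH hμ hL m hS
  have hcoord : ∀ x i, gradient U x i = fderiv ℝ U x (EuclideanSpace.single i 1) := fun x i => by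
    rw [← inner_gradient, inner_single_one]
  have hg : ∀ (x : Vec d) (i : Fin d), |fderiv ℝ U x (EuclideanSpace.single i 1)| ≤
      ‖gradient U 0‖ + L * ‖x‖ := fun x i => by
    rw [← hcoord]
    exact (PiLp.norm_apply_le (gradient U x) i).trans (norm_gradient_le hU hH hμ hL x)
  have hint : ∀ i, Integrable (fun x => fderiv ℝ U x (EuclideanSpace.single i 1) * (x i - m i))
      (gaussian m S) := by
    intro i
    have h := integrable_gaussian_inner m hS
      (f := fun x => fderiv ℝ U x (EuclideanSpace.single i 1) • EuclideanSpace.single i 1)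
      (g := fun x => x - m)
      ((hU.fderiv_apply_const _).continuous.smul continuous_const)
      (continuous_id.sub continuous_const) ‖gradient U 0‖ L ‖m‖ 1
      (fun x => by
        rw [norm_smul, PiLp.norm_single, norm_one, mul_one]
        exact hg x i)
      fun x => by linarith [norm_sub_le x m]
    simpa only [real_inner_smul_left, real_inner_comm _ (EuclideanSpace.single i (1 : ℝ)),
      inner_single_one, PiLp.sub_apply] using h
  rw [integral_gaussian_inner_matVec m hS]
  simp only [inner_eq_sum, PiLp.sub_apply, hcoord]
  rw [integral_finsetSum _ fun i _ => hint i, Finset.sum_comm]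
  refine Finset.sum_congr rfl fun i _ => ?_
  have hstein := integral_gaussian_fderiv_col m hS
    (hU.fderiv_apply_const (EuclideanSpace.single i 1)) i ‖gradient U 0‖ L
    (‖matVec S (EuclideanSpace.single i 1)‖ * L) (fun x => hg x i) fun x => by
      rw [hU.fderiv_fderiv_apply]
      refine (abs_real_inner_le_norm _ _).trans ?_
      have h := (hH x).norm_matVec_le hμ hL (EuclideanSpace.single i 1)
      simp only [PiLp.norm_single, norm_one, mul_one] at h
      gcongr
  rw [← hstein]
  have hsum : ∀ x, fderiv ℝ (fun y => fderiv ℝ U y (EuclideanSpace.single i 1)) x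
      (matVec S (EuclideanSpace.single i 1)) = ∑ k, hess U x k i * S k i := fun x => by
    rw [hU.fderiv_fderiv_apply, inner_matVec]
    simp [matVec_apply]
  simp only [hsum]
  rw [integral_finsetSum _ fun k _ => (hi k i).mul_const _]
  refine Finset.sum_congr rfl fun k _ => ?_
  rw [integral_mul_const]
  rfl

end Pinched

/-! ### Moments at a stationary Gaussian and along a coupling -/

section Stationary

variable {U : Vec d → ℝ} {μ L : ℝ}

lemma mul_integral_norm_sub_sq_le (hU : ContDiff ℝ 2 U) (hH : ∀ x, IsPinched μ L (hess U x))
    (hμ : 0 ≤ μ) (hL : 0 < L) (m : Vec d) {S : Mat d} (hS : S.PosDef)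
    [IsProbabilityMeasure (gaussian m S)] (hstat : intHess U (gaussian m S) = S⁻¹) :
    μ * ∫ x, ‖x - m‖ ^ 2 ∂gaussian m S ≤ d := by
  have hP := hstat ▸ isPinched_intHess hU hH hμ hL m hS
  have hlin : Continuous fun x : Vec d => x - m := continuous_id.sub continuous_const
  have hb : ∀ x : Vec d, ‖x - m‖ ≤ ‖m‖ + 1 * ‖x‖ := fun x => by linarith [norm_sub_le x m]
  rw [← integral_gaussian_inner_inv m hS, ← integral_const_mul]
  refine integral_mono ((integrable_gaussian_norm_sq m hS hlin _ _ hb).const_mul _)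
    (integrable_gaussian_inner m hS hlin (continuous_matVec (fun _ _ => continuous_const) hlin)
      _ _ (L * ‖m‖) L hb fun x => (hP.norm_matVec_le hμ hL _).trans ?_)
    fun x => hP.lower _
  nlinarith [hb x]

lemma integral_norm_matVec_inv_sq_le (hU : ContDiff ℝ 2 U)
    (hH : ∀ x, IsPinched μ L (hess U x)) (hμ : 0 ≤ μ) (hL : 0 < L) (m : Vec d) {S : Mat d}
    (hS : S.PosDef) [IsProbabilityMeasure (gaussian m S)]
    (hstat : intHess U (gaussian m S) = S⁻¹) :
    ∫ x, ‖matVec S⁻¹ (x - m)‖ ^ 2 ∂gaussian m S ≤ L * d := by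
  have hP := hstat ▸ isPinched_intHess hU hH hμ hL m hS
  have hlin : Continuous fun x : Vec d => x - m := continuous_id.sub continuous_const
  have hb : ∀ x : Vec d, ‖x - m‖ ≤ ‖m‖ + 1 * ‖x‖ := fun x => by linarith [norm_sub_le x m]
  have hM : Continuous fun x : Vec d => matVec S⁻¹ (x - m) :=
    continuous_matVec (A := fun _ => S⁻¹) (fun _ _ => continuous_const) hlin
  have hMb : ∀ x : Vec d, ‖matVec S⁻¹ (x - m)‖ ≤ L * ‖m‖ + L * ‖x‖ := fun x =>
    (hP.norm_matVec_le hμ hL _).trans (by nlinarith [hb x])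
  have hi : Integrable (fun x => ⟪x - m, matVec S⁻¹ (x - m)⟫) (gaussian m S) :=
    integrable_gaussian_inner m hS hlin hM _ _ _ _ hb hMb
  have hle : ∀ x : Vec d, ‖matVec S⁻¹ (x - m)‖ ^ 2 ≤ L * ⟪x - m, matVec S⁻¹ (x - m)⟫ :=
    fun x => hP.norm_matVec_sq_le hμ hL _
  rw [← integral_gaussian_inner_inv m hS, ← integral_const_mul]
  exact integral_mono_of_nonneg (Filter.Eventually.of_forall fun x => sq_nonneg _)
    (hi.const_mul L) (Filter.Eventually.of_forall hle)

lemma integrable_norm_gradient_sq (hU : ContDiff ℝ 2 U) (hH : ∀ x, IsPinched μ L (hess U x))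
    (hμ : 0 ≤ μ) (hL : 0 < L) (m : Vec d) {S : Mat d} (hS : S.PosDef) :
    Integrable (fun x => ‖gradient U x‖ ^ 2) (gaussian m S) :=
  integrable_gaussian_norm_sq m hS hU.continuous_gradient _ _ (norm_gradient_le hU hH hμ hL)

lemma integrable_inner_gradient (hU : ContDiff ℝ 2 U) (hH : ∀ x, IsPinched μ L (hess U x))
    (hμ : 0 ≤ μ) (hL : 0 < L) (m : Vec d) {S : Mat d} (hS : S.PosDef) :
    Integrable (fun x => ⟪gradient U x, x - m⟫) (gaussian m S) :=
  integrable_gaussian_inner m hS hU.continuous_gradient (continuous_id.sub continuous_const)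
    _ _ ‖m‖ 1 (norm_gradient_le hU hH hμ hL) fun x => by linarith [norm_sub_le x m]

lemma integral_inner_gradient_eq_dim (hU : ContDiff ℝ 2 U)
    (hH : ∀ x, IsPinched μ L (hess U x)) (hμ : 0 ≤ μ) (hL : 0 < L) (m : Vec d) {S : Mat d}
    (hS : S.PosDef) [IsProbabilityMeasure (gaussian m S)]
    (hstat : intHess U (gaussian m S) = S⁻¹) :
    ∫ x, ⟪gradient U x, x - m⟫ ∂gaussian m S = d := by
  rw [integral_gaussian_inner_gradient hU hH hμ hL m hS, hstat, integral_gaussian_inner_inv m hS]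

lemma integral_norm_gradient_sq_le (hU : ContDiff ℝ 2 U) (hH : ∀ x, IsPinched μ L (hess U x))
    (hμ : 0 ≤ μ) (hL : 0 < L) (m : Vec d) {S : Mat d} (hS : S.PosDef)
    [IsProbabilityMeasure (gaussian m S)] (hstat₁ : intGrad U (gaussian m S) = 0)
    (hstat₂ : intHess U (gaussian m S) = S⁻¹) :
    ∫ x, ‖gradient U x‖ ^ 2 ∂gaussian m S ≤ L * d := by
  have hg := integrable_gradient hU hH hμ hL m hS
  have hi₁ := (integrable_inner_gradient hU hH hμ hL m hS).const_mul L
  have hi₂ := ((integrable_gaussian_id m hS).const_inner (𝕜 := ℝ) (gradient U m)).const_mul L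
  have hi₃ := (hg.const_inner (𝕜 := ℝ) (gradient U m)).const_mul 2
  have hpt : ∀ x, ‖gradient U x‖ ^ 2 ≤ L * ⟪gradient U x, x - m⟫ - L * ⟪gradient U m, x - m⟫ +
      2 * ⟪gradient U m, gradient U x⟫ := fun x => by
    have h := norm_gradient_sub_sq_le_inner hU hH hμ hL x m
    rw [norm_sub_sq_real, inner_sub_left, real_inner_comm] at h
    linarith [sq_nonneg ‖gradient U m‖]
  refine (integral_mono_of_nonneg (Filter.Eventually.of_forall fun x => sq_nonneg _)
    ((hi₁.sub hi₂).add hi₃) (Filter.Eventually.of_forall hpt)).trans_eq ?_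
  have hzero : ∫ x, ⟪gradient U m, gradient U x⟫ ∂gaussian m S = 0 := by
    rw [integral_inner hg]
    exact (congrArg (inner ℝ (gradient U m)) hstat₁).trans (inner_zero_right _)
  rw [integral_add' (hi₁.sub hi₂) hi₃, integral_sub' hi₁ hi₂, integral_const_mul,
    integral_const_mul, integral_const_mul, integral_gaussian_inner_sub m hS,
    integral_inner_gradient_eq_dim hU hH hμ hL m hS hstat₂, hzero]
  ring

end Stationary

lemma two_mul_inner_le {s : ℝ} (hs : 0 < s) (u v : Vec d) :
    2 * ⟪u, v⟫ ≤ s⁻¹ * ‖u‖ ^ 2 + s * ‖v‖ ^ 2 := by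
  have h := mul_nonneg (inv_nonneg.mpr hs.le) (sq_nonneg ‖u - s • v‖)
  rw [norm_sub_sq_real, real_inner_smul_right, norm_smul, Real.norm_of_nonneg hs.le] at h
  have : s⁻¹ * (‖u‖ ^ 2 - 2 * (s * ⟪u, v⟫) + (s * ‖v‖) ^ 2) =
      s⁻¹ * ‖u‖ ^ 2 + s * ‖v‖ ^ 2 - 2 * ⟪u, v⟫ := by
    field_simp
    ring
  linarith

section Coupling

variable {ψ : Measure (Vec d × Vec d)} {p q : Measure (Vec d)}

lemma IsCoupling.left {E : Type*} [NormedAddCommGroup E] [NormedSpace ℝ E]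
    (hψ : IsCoupling ψ p q) {f : Vec d → E} (hf : Integrable f p) :
    Integrable (fun z => f z.1) ψ ∧ ∫ z, f z.1 ∂ψ = ∫ x, f x ∂p := by
  rw [← hψ.2.1] at hf ⊢
  exact ⟨hf.comp_measurable measurable_fst,
    (integral_map measurable_fst.aemeasurable hf.aestronglyMeasurable).symm⟩

lemma IsCoupling.right {E : Type*} [NormedAddCommGroup E] [NormedSpace ℝ E]
    (hψ : IsCoupling ψ p q) {f : Vec d → E} (hf : Integrable f q) :
    Integrable (fun z => f z.2) ψ ∧ ∫ z, f z.2 ∂ψ = ∫ x, f x ∂q := by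
  rw [← hψ.2.2] at hf ⊢
  exact ⟨hf.comp_measurable measurable_snd,
    (integral_map measurable_snd.aemeasurable hf.aestronglyMeasurable).symm⟩

lemma IsCoupling.isProbabilityMeasure_left (hψ : IsCoupling ψ p q) : IsProbabilityMeasure p := by
  have := hψ.1
  rw [← hψ.2.1]
  exact Measure.isProbabilityMeasure_map measurable_fst.aemeasurable

lemma IsCoupling.isProbabilityMeasure_right (hψ : IsCoupling ψ p q) : IsProbabilityMeasure q := by
  have := hψ.1
  rw [← hψ.2.2]
  exact Measure.isProbabilityMeasure_map measurable_snd.aemeasurable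

variable {U : Vec d → ℝ} {μ L : ℝ} {m mstar : Vec d} {S Sstar : Mat d}

lemma integrable_bregman (hU : ContDiff ℝ 2 U) (hH : ∀ x, IsPinched μ L (hess U x))
    (hμ : 0 ≤ μ) (hL : 0 < L) (hS : S.PosDef) (hSstar : Sstar.PosDef)
    (hψ : IsCoupling ψ (gaussian m S) (gaussian mstar Sstar)) :
    Integrable (fun z => bregman U z.1 z.2) ψ := by
  have h₁ := (hψ.left (integrable_gaussian_norm_sq m hS continuous_id 0 1 (by simp))).1
  have h₂ := (hψ.right (integrable_gaussian_norm_sq mstar hSstar continuous_id 0 1 (by simp))).1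
  refine ((h₁.add h₂).const_mul L).mono' ?_ (Filter.Eventually.of_forall fun z => ?_)
  · have hg := hU.continuous_gradient.comp (continuous_snd (X := Vec d) (Y := Vec d))
    have hc := hU.continuous
    exact (((hc.comp continuous_fst).sub (hc.comp continuous_snd)).sub
      (hg.inner (continuous_fst.sub continuous_snd))).aestronglyMeasurable
  · have hlow := (mul_nonneg (div_nonneg hμ zero_le_two) (sq_nonneg _)).trans
      (mul_norm_sq_le_bregman hU hH z.1 z.2)
    rw [Real.norm_of_nonneg hlow]
    refine (bregman_le_mul_norm_sq hU hH _ _).trans ?_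
    have h : ‖z.1 - z.2‖ ^ 2 ≤ 2 * (‖z.1‖ ^ 2 + ‖z.2‖ ^ 2) := by
      nlinarith [norm_sub_le z.1 z.2, norm_nonneg (z.1 - z.2), sq_nonneg (‖z.1‖ - ‖z.2‖)]
    simp only [Pi.add_apply, id]
    nlinarith

/-- The second moment of the gradient under the first marginal. -/
lemma integral_norm_gradient_sq_le_bregman (hU : ContDiff ℝ 2 U)
    (hH : ∀ x, IsPinched μ L (hess U x)) (hμ : 0 ≤ μ) (hL : 0 < L) (hS : S.PosDef)
    (hSstar : Sstar.PosDef) (hstat₁ : intGrad U (gaussian mstar Sstar) = 0)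
    (hstat₂ : intHess U (gaussian mstar Sstar) = Sstar⁻¹)
    (hψ : IsCoupling ψ (gaussian m S) (gaussian mstar Sstar)) :
    ∫ x, ‖gradient U x‖ ^ 2 ∂gaussian m S ≤ 4 * L * ∫ z, bregman U z.1 z.2 ∂ψ + 2 * L * d := by
  have := hψ.isProbabilityMeasure_right
  have hD := (integrable_bregman hU hH hμ hL hS hSstar hψ).const_mul (4 * L)
  obtain ⟨hg, hg'⟩ := hψ.right (integrable_norm_gradient_sq hU hH hμ hL mstar hSstar)
  rw [← (hψ.left (integrable_norm_gradient_sq hU hH hμ hL m hS)).2]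
  calc _ ≤ ∫ z, (4 * L * bregman U z.1 z.2 + 2 * ‖gradient U z.2‖ ^ 2) ∂ψ := by
        refine integral_mono_of_nonneg (Filter.Eventually.of_forall fun z => sq_nonneg _)
          (hD.add (hg.const_mul 2)) (Filter.Eventually.of_forall fun z => ?_)
        have h := norm_gradient_sub_sq_le_bregman hU hH hμ hL z.1 z.2
        have h' : ‖gradient U z.1‖ ≤ ‖gradient U z.1 - gradient U z.2‖ + ‖gradient U z.2‖ := by
          simpa using norm_add_le (gradient U z.1 - gradient U z.2) (gradient U z.2)
        simp only
        nlinarith [norm_nonneg (gradient U z.1),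
          sq_nonneg (‖gradient U z.1 - gradient U z.2‖ - ‖gradient U z.2‖)]
    _ = 4 * L * ∫ z, bregman U z.1 z.2 ∂ψ +
        2 * ∫ x, ‖gradient U x‖ ^ 2 ∂gaussian mstar Sstar := by
        rw [integral_add hD (hg.const_mul 2), integral_const_mul, integral_const_mul, hg']
    _ ≤ _ := by
        linarith [integral_norm_gradient_sq_le hU hH hμ hL mstar hSstar hstat₁ hstat₂]

lemma inner_gradient_le_bregman (hU : ContDiff ℝ 2 U) (hH : ∀ x, IsPinched μ L (hess U x))
    (hμ : 0 < μ) (hμL : μ ≤ L) (x y m n : Vec d) :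
    ⟪gradient U x, x - m⟫ ≤ 4 * (L / μ) * bregman U x y + μ / 2 * ‖y - n‖ ^ 2 +
      ⟪gradient U y, y - n⟫ + (2 * L)⁻¹ * ‖gradient U y‖ ^ 2 +
      (μ + L) * (⟪m - n, y - n⟫ - ⟪m - n, x - m⟫) := by
  have hL : 0 < L := hμ.trans_le hμL
  set Δ := gradient U x - gradient U y with hΔ
  set η := (x - m) - (y - n) with hη
  have hκ : μ⁻¹ * ‖Δ‖ ^ 2 ≤ 2 * (L / μ) * bregman U x y := by
    calc _ ≤ μ⁻¹ * (2 * L * bregman U x y) := by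
          gcongr
          exact norm_gradient_sub_sq_le_bregman hU hH hμ.le hL x y
      _ = _ := by field_simp
  have h₁ := two_mul_inner_le hμ Δ (y - n)
  have h₂ := two_mul_inner_le hμ Δ η
  have h₃ := two_mul_inner_le hL (gradient U y) η
  have hsplit : ⟪gradient U x, x - m⟫ =
      ⟪Δ, y - n⟫ + ⟪Δ, η⟫ + ⟪gradient U y, y - n⟫ + ⟪gradient U y, η⟫ := by
    rw [hΔ, hη]
    simp only [inner_sub_left, inner_sub_right]
    ring
  have hlow := mul_norm_sq_le_bregman hU hH x y
  have hD : 0 ≤ bregman U x y := (by positivity : 0 ≤ μ / 2 * ‖x - y‖ ^ 2).trans hlow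
  have hηsq : ‖η‖ ^ 2 ≤ ‖x - y‖ ^ 2 + 2 * (⟪m - n, y - n⟫ - ⟪m - n, x - m⟫) := by
    have he : x - y = η + (m - n) := by rw [hη]; abel
    have hi : ⟪η, m - n⟫ = ⟪m - n, x - m⟫ - ⟪m - n, y - n⟫ := by
      rw [hη, real_inner_comm, inner_sub_right]
    rw [he, norm_add_sq_real, hi]
    linarith [sq_nonneg ‖m - n‖]
  have hW : (μ + L) / 2 * ‖x - y‖ ^ 2 ≤ 2 * (L / μ) * bregman U x y := by
    calc _ ≤ L * ‖x - y‖ ^ 2 := by gcongr; linarith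
      _ = 2 * (L / μ) * (μ / 2 * ‖x - y‖ ^ 2) := by field_simp
      _ ≤ _ := by gcongr
  have hηsq' := mul_le_mul_of_nonneg_left hηsq (by positivity : 0 ≤ (μ + L) / 2)
  rw [mul_inv]
  nlinarith

/-- The Stein term of the first marginal is controlled by the Bregman transport cost. -/
lemma integral_inner_gradient_le_bregman (hU : ContDiff ℝ 2 U)
    (hH : ∀ x, IsPinched μ L (hess U x)) (hμ : 0 < μ) (hμL : μ ≤ L) (hS : S.PosDef)
    (hSstar : Sstar.PosDef) (hstat₁ : intGrad U (gaussian mstar Sstar) = 0)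
    (hstat₂ : intHess U (gaussian mstar Sstar) = Sstar⁻¹)
    (hψ : IsCoupling ψ (gaussian m S) (gaussian mstar Sstar)) :
    ∫ x, ⟪gradient U x, x - m⟫ ∂gaussian m S ≤
      4 * (L / μ) * ∫ z, bregman U z.1 z.2 ∂ψ + 2 * d := by
  have := hψ.isProbabilityMeasure_right
  have hL : 0 < L := hμ.trans_le hμL
  obtain ⟨hl, hl'⟩ := hψ.left (integrable_inner_gradient hU hH hμ.le hL m hS)
  have hD := (integrable_bregman hU hH hμ.le hL hS hSstar hψ).const_mul (4 * (L / μ))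
  obtain ⟨hy, hy'⟩ := hψ.right (integrable_gaussian_norm_sq mstar hSstar
    (f := fun x => x - mstar) (continuous_id.sub continuous_const) ‖mstar‖ 1
    fun x => by linarith [norm_sub_le x mstar])
  obtain ⟨hs, hs'⟩ := hψ.right (integrable_inner_gradient hU hH hμ.le hL mstar hSstar)
  obtain ⟨hg, hg'⟩ := hψ.right (integrable_norm_gradient_sq hU hH hμ.le hL mstar hSstar)
  obtain ⟨hc, hc'⟩ := hψ.right ((integrable_gaussian_id mstar hSstar).const_inner (𝕜 := ℝ)
    (m - mstar))
  obtain ⟨hb, hb'⟩ := hψ.left ((integrable_gaussian_id m hS).const_inner (𝕜 := ℝ) (m - mstar))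
  have hy₂ := hy.const_mul (μ / 2)
  have hg₂ := hg.const_mul (2 * L)⁻¹
  have hc₂ := (hc.sub hb).const_mul (μ + L)
  rw [← hl']
  refine (integral_mono hl ((((hD.add hy₂).add hs).add hg₂).add hc₂) fun z =>
    inner_gradient_le_bregman hU hH hμ hμL z.1 z.2 m mstar).trans ?_
  rw [integral_add' (((hD.add hy₂).add hs).add hg₂) hc₂, integral_add' ((hD.add hy₂).add hs) hg₂,
    integral_add' (hD.add hy₂) hs, integral_add' hD hy₂, integral_const_mul, integral_const_mul,
    integral_const_mul, integral_const_mul, integral_sub' hc hb, hs', hc', hb', hy', hg',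
    integral_gaussian_inner_sub m hS, integral_gaussian_inner_sub mstar hSstar,
    integral_inner_gradient_eq_dim hU hH hμ.le hL mstar hSstar hstat₂]
  have h₁ := mul_integral_norm_sub_sq_le hU hH hμ.le hL mstar hSstar hstat₂
  have h₂ := mul_le_mul_of_nonneg_left
    (integral_norm_gradient_sq_le hU hH hμ.le hL mstar hSstar hstat₁ hstat₂)
    (by positivity : 0 ≤ (2 * L)⁻¹)
  have h₃ : (2 * L)⁻¹ * (L * d) = (d : ℝ) / 2 := by field_simp
  linarith

end Coupling

section Estimator

variable {U : Vec d → ℝ} {μ L : ℝ}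

lemma norm_gradient_add_matVec_sub_sq_le (hH : ∀ x, IsPinched μ L (hess U x)) (hμ : 0 ≤ μ)
    (hL : 0 < L) (z u c : Vec d) :
    ‖gradient U z + matVec (hess U z) u - c‖ ^ 2 ≤
      ‖gradient U z‖ ^ 2 + 2 * ⟪u, matVec (hess U z) (gradient U z)⟫ - 2 * ⟪c, gradient U z⟫ +
        3 / 2 * L * ⟪u, matVec (hess U z) u⟫ + 3 * ‖c‖ ^ 2 := by
  have h₁ := (hH z).norm_matVec_sq_le hμ hL u
  have h₂ : ⟪gradient U z, matVec (hess U z) u⟫ = ⟪u, matVec (hess U z) (gradient U z)⟫ := by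
    rw [(hH z).symm, real_inner_comm]
  have h₃ := two_mul_inner_le (s := 2) two_pos (matVec (hess U z) u) (-c)
  rw [inner_neg_right, norm_neg] at h₃
  rw [add_sub_assoc, norm_add_sq_real, norm_sub_sq_real, inner_sub_right, h₂, real_inner_comm c]
  linarith

lemma integral_norm_gradient_add_matVec_sub_sq_le (hU : ContDiff ℝ 2 U)
    (hH : ∀ x, IsPinched μ L (hess U x)) (hμ : 0 ≤ μ) (hL : 0 < L) {m : Vec d} {S : Mat d}
    (hS : S.PosDef) [IsProbabilityMeasure (gaussian m S)] (u c : Vec d) :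
    ∫ z, ‖gradient U z + matVec (hess U z) u - c‖ ^ 2 ∂gaussian m S ≤
      ∫ z, ‖gradient U z‖ ^ 2 ∂gaussian m S +
        2 * ⟪∫ z, matVec (hess U z) (gradient U z) ∂gaussian m S, u⟫ -
        2 * ⟪intGrad U (gaussian m S), c⟫ +
        3 / 2 * L * ⟪u, matVec (intHess U (gaussian m S)) u⟫ + 3 * ‖c‖ ^ 2 := by
  have hg := integrable_gradient hU hH hμ hL m hS
  have hg₂ := integrable_norm_gradient_sq hU hH hμ hL m hS
  have hHg : Integrable (fun z => matVec (hess U z) (gradient U z)) (gaussian m S) :=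
    integrable_gaussian_of_le_linear m hS
      (continuous_matVec hU.continuous_hess hU.continuous_gradient) (L * ‖gradient U 0‖) (L * L)
      fun z => by
        calc _ ≤ L * ‖gradient U z‖ := (hH z).norm_matVec_le hμ hL _
          _ ≤ L * (‖gradient U 0‖ + L * ‖z‖) := by
            gcongr
            exact norm_gradient_le hU hH hμ hL z
          _ = _ := by ring
  have hHu : Integrable (fun z => ⟪u, matVec (hess U z) u⟫) (gaussian m S) :=
    Integrable.const_inner (𝕜 := ℝ) u <| integrable_gaussian_of_le_linear m hS
      (continuous_matVec hU.continuous_hess continuous_const) (L * ‖u‖) 0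
      fun z => by simpa using (hH z).norm_matVec_le hμ hL u
  have h₁ := (hHg.const_inner (𝕜 := ℝ) u).const_mul 2
  have h₂ := (hg.const_inner (𝕜 := ℝ) c).const_mul 2
  have h₃ := hHu.const_mul (3 / 2 * L)
  have h₄ : Integrable (fun _ => 3 * ‖c‖ ^ 2) (gaussian m S) := integrable_const _
  refine (integral_mono_of_nonneg (Filter.Eventually.of_forall fun z => sq_nonneg _)
    ((((hg₂.add h₁).sub h₂).add h₃).add h₄) (Filter.Eventually.of_forall fun z =>
      norm_gradient_add_matVec_sub_sq_le hH hμ hL z u c)).trans_eq ?_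
  rw [integral_add' (((hg₂.add h₁).sub h₂).add h₃) h₄, integral_add' ((hg₂.add h₁).sub h₂) h₃,
    integral_sub' (hg₂.add h₁) h₂, integral_add' hg₂ h₁, integral_const_mul, integral_const_mul,
    integral_const_mul, integral_inner hHg, integral_inner hg, inner_matVec_intHess hU hH hμ hL m hS,
    real_inner_comm u, real_inner_comm c, integral_const, probReal_univ, one_smul]
  rfl

end Estimator

/-- **Variance bound for the Bonnet–Price estimator of the Bures–Wasserstein
gradient** (Lemma 3.3).  Integrating over `z ∼ q` independently of
`(x, x_*) ∼ ψ`, with `g_* = ∫∇U dq_*`, `H_* = ∫∇²U dq_*` and `κ = L/μ`: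
`∫∫ ‖(∇U(z) + ∇²U(z)(x−m)) − (g_* + H_*(x_*−m_*))‖² dψ dq ≤ 10Lκ·∫ D_U dψ + 10dL`. -/
theorem bonnet_price_bw_gradient_variance_bound
    (d : ℕ) (hd : 0 < d) (U : Vec d → ℝ) (μ L : ℝ) (hμ : 0 < μ) (hμL : μ ≤ L)
    (hU : ContDiff ℝ 2 U)
    (hconv : ∀ x : Vec d,
      (hess U x - μ • 1).PosSemidef ∧ ((L • (1 : Mat d)) - hess U x).PosSemidef)
    (m : Vec d) (S : Mat d) (hS : S.PosDef)
    (mstar : Vec d) (Sstar : Mat d) (hSstar : Sstar.PosDef)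
    (hstat1 : intGrad U (gaussian mstar Sstar) = 0)
    (hstat2 : intHess U (gaussian mstar Sstar) = Sstar⁻¹)
    (ψ : Measure (Vec d × Vec d))
    (hψ : IsCoupling ψ (gaussian m S) (gaussian mstar Sstar)) :
    (∫ p, (∫ z, ‖(gradient U z + matVec (hess U z) (p.1 - m)) -
            (intGrad U (gaussian mstar Sstar) +
              matVec (intHess U (gaussian mstar Sstar)) (p.2 - mstar))‖ ^ 2
          ∂(gaussian m S)) ∂ψ)
      ≤ 10 * L * (L / μ) * (∫ p, bregman U p.1 p.2 ∂ψ) + 10 * d * L := by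
  have hL : 0 < L := hμ.trans_le hμL
  have hH : ∀ x, IsPinched μ L (hess U x) := fun x => .of_posSemidef (hconv x).1 (hconv x).2
  have := hψ.1
  have := hψ.isProbabilityMeasure_left
  have := hψ.isProbabilityMeasure_right
  have hP : IsPinched μ L Sstar⁻¹ := hstat2 ▸ isPinched_intHess hU hH hμ.le hL mstar hSstar
  have hlin : ∀ n : Vec d, Continuous fun x => x - n := fun n => continuous_id.sub continuous_const
  have hn : ∀ x n : Vec d, ‖x - n‖ ≤ ‖n‖ + 1 * ‖x‖ := fun x n => by linarith [norm_sub_le x n]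
  set A := ∫ z, ‖gradient U z‖ ^ 2 ∂gaussian m S with hA
  set b := ∫ z, matVec (hess U z) (gradient U z) ∂gaussian m S
  set g := intGrad U (gaussian m S)
  set K := intHess U (gaussian m S) with hK
  have hKP : IsPinched μ L K := isPinched_intHess hU hH hμ.le hL m hS
  obtain ⟨hb, hb'⟩ := hψ.left ((integrable_gaussian_id m hS).const_inner (𝕜 := ℝ) b)
  obtain ⟨hg, hg'⟩ := hψ.right
    ((integrable_gaussian_id mstar hSstar).const_inner (𝕜 := ℝ) (matVec Sstar⁻¹ g))
  obtain ⟨hq, hq'⟩ := hψ.left (integrable_gaussian_inner m hS (hlin m)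
    (continuous_matVec (A := fun _ => K) (fun _ _ => continuous_const) (hlin m)) _ _ (L * ‖m‖) L
    (fun x => hn x m) fun x => (hKP.norm_matVec_le hμ.le hL _).trans (by nlinarith [hn x m]))
  obtain ⟨hc, hc'⟩ := hψ.right (integrable_gaussian_norm_sq mstar hSstar
    (continuous_matVec (A := fun _ => Sstar⁻¹) (fun _ _ => continuous_const) (hlin mstar))
    (L * ‖mstar‖) L
    fun x => (hP.norm_matVec_le hμ.le hL _).trans (by nlinarith [hn x mstar]))
  have hA₁ : Integrable (fun _ => A) ψ := integrable_const _
  have hb₁ := hb.const_mul 2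
  have hg₁ := hg.const_mul 2
  have hq₁ := hq.const_mul (3 / 2 * L)
  have hc₁ := hc.const_mul 3
  rw [hstat1, hstat2]
  refine (integral_mono_of_nonneg
    (Filter.Eventually.of_forall fun p => integral_nonneg fun z => sq_nonneg _)
    ((((hA₁.add hb₁).sub hg₁).add hq₁).add hc₁) (Filter.Eventually.of_forall fun p => ?_)).trans ?_
  · have h := integral_norm_gradient_add_matVec_sub_sq_le hU hH hμ.le hL hS (m := m) (p.1 - m)
      (matVec Sstar⁻¹ (p.2 - mstar))
    rw [hP.symm g] at h
    simp only [zero_add]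
    exact h
  rw [integral_add' (((hA₁.add hb₁).sub hg₁).add hq₁) hc₁,
    integral_add' ((hA₁.add hb₁).sub hg₁) hq₁, integral_sub' (hA₁.add hb₁) hg₁,
    integral_add' hA₁ hb₁, integral_const_mul, integral_const_mul, integral_const_mul,
    integral_const_mul, hb', hg', hq', hc', integral_gaussian_inner_sub m hS,
    integral_gaussian_inner_sub mstar hSstar, integral_const, probReal_univ, one_smul, hK,
    ← integral_gaussian_inner_gradient hU hH hμ.le hL m hS]
  have hAle := integral_norm_gradient_sq_le_bregman hU hH hμ.le hL hS hSstar hstat1 hstat2 hψ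
  have hTle := mul_le_mul_of_nonneg_left
    (integral_inner_gradient_le_bregman hU hH hμ hμL hS hSstar hstat1 hstat2 hψ)
    (by positivity : 0 ≤ 3 / 2 * L)
  have hcle := integral_norm_matVec_inv_sq_le hU hH hμ.le hL mstar hSstar hstat2
  have hD : 0 ≤ ∫ p, bregman U p.1 p.2 ∂ψ := integral_nonneg fun p =>
    (by positivity : 0 ≤ μ / 2 * ‖p.1 - p.2‖ ^ 2).trans (mul_norm_sq_le_bregman hU hH p.1 p.2)
  have hκ : L * (∫ p, bregman U p.1 p.2 ∂ψ) ≤ L * (L / μ) * ∫ p, bregman U p.1 p.2 ∂ψ := by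
    have h1 : 1 ≤ L / μ := (one_le_div hμ).mpr hμL
    gcongr
    exact le_mul_of_one_le_right hL.le h1
  have hdL : 0 ≤ (d : ℝ) * L := by positivity
  linarith
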